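/- (Lemma 4 of the paper, pointwise form.) Let S, A be finite nonempty sets, γ ∈ [0,1), Rmax > 0, λ with λ² > 8, and Qπ : S×A → ℝ with ‖Qπ‖∞ ≤ Rmax/(1−γ). For i = 1,…,N let R_i, P_i be task rewards and transition kernels with |R_i(s,a)| ≤ Rmax, satisfying for every (s,a): |R_i(s,a) − (1/N)Σ_j R_j(s,a)| ≤ σ_{1,i} and Σ_{s'} |P_i(s'|s,a) − (1/N)Σ_j P_j(s'|s,a)| ≤ σ_{2,i}. Let Q_i* be the unique fixed point of the task-i regularized Bellman operator B̂_i, and assume ‖Q_i*‖∞ ≤ Rmax/(1−γ). Define g_i(s,a) = λ·(Qπ(s,a) − Q_i*(s,a)) and ḡ(s,a) = (1/N)Σ_{i=1}^N g_i(s,a). Then for every (s,a): (1/N)·Σ_{i=1}^N ( g_i(s,a) − ḡ(s,a) )² ≤ (8/(λ²−8))·ḡ(s,a)² + 2·σ₂², where σ₂² = (2λ²/(λ²−8))·σ² + (2λ²γ/((λ²−8)(1−γ)))·Rmax and σ² = (1/N)·Σ_{i=1}^N ( σ_{1,i} + σ_{2,i}·γ·Rmax/(1−γ) )². -/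

import Mathlib

open Finset

/-- Max over actions of a Q-table at a state. -/
noncomputable def maxQ {S A : Type*} [Fintype A] [Nonempty A] (Q : S × A → ℝ) (s : S) : ℝ :=
  Finset.univ.sup' Finset.univ_nonempty (fun a => Q (s, a))

/-- The regularized Bellman operator. -/
noncomputable def Bhat {S A : Type*} [Fintype S] [Fintype A] [Nonempty A]
    (P : S → A → S → ℝ) (R : S → A → ℝ) (γ lam : ℝ) (Qpi : S × A → ℝ)
    (Q : S × A → ℝ) : S × A → ℝ :=
  fun sa => (lam / (1 + lam)) * Qpi sa +
    (1 / (1 + lam)) * (R sa.1 sa.2 + γ * ∑ s' : S, P sa.1 sa.2 s' * maxQ Q s')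

theorem abs_maxQ_sub_le {S A : Type*} [Fintype S] [Fintype A] [Nonempty A]
    (Q Q' : S × A → ℝ) (s : S) : |maxQ Q s - maxQ Q' s| ≤ ‖Q - Q'‖ := by
  have key : ∀ F G : S × A → ℝ, maxQ F s ≤ maxQ G s + ‖F - G‖ := by
    intro F G
    refine Finset.sup'_le _ _ fun a _ => ?_
    have h1 : G (s, a) ≤ maxQ G s :=
      Finset.le_sup' (fun a => G (s, a)) (Finset.mem_univ a)
    have h2 := (le_abs_self _).trans (norm_le_pi_norm (F - G) (s, a))
    rw [Pi.sub_apply] at h2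
    linarith
  have h1 := key Q Q'
  have h2 := key Q' Q
  rw [norm_sub_rev] at h2
  exact abs_sub_le_iff.2 ⟨by linarith, by linarith⟩

theorem abs_maxQ_le {S A : Type*} [Fintype S] [Fintype A] [Nonempty A]
    (Q : S × A → ℝ) (s : S) : |maxQ Q s| ≤ ‖Q‖ := by
  have h := abs_maxQ_sub_le Q 0 s
  simpa [maxQ] using h

theorem abs_sum_mul_le {S : Type*} [Fintype S] (p v : S → ℝ) {c M : ℝ} (hM : 0 ≤ M)
    (hp : ∑ s, |p s| ≤ c) (hv : ∀ s, |v s| ≤ M) : |∑ s, p s * v s| ≤ c * M :=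
  calc |∑ s, p s * v s| ≤ ∑ s, |p s * v s| := Finset.abs_sum_le_sum_abs _ _
    _ ≤ ∑ s, |p s| * M := Finset.sum_le_sum fun s _ => by
        rw [abs_mul]; exact mul_le_mul_of_nonneg_left (hv s) (abs_nonneg _)
    _ = (∑ s, |p s|) * M := (Finset.sum_mul _ _ _).symm
    _ ≤ c * M := mul_le_mul_of_nonneg_right hp hM

theorem sum_sq_sub_mean {N : ℕ} (hN : 1 ≤ N) (x : Fin N → ℝ) :
    ∑ i, (x i - (1 / (N : ℝ)) * ∑ j, x j) ^ 2 = ∑ i, x i ^ 2 - (∑ i, x i) ^ 2 / N := by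
  have hN' : (N : ℝ) ≠ 0 := by positivity
  simp only [sub_sq, Finset.sum_add_distrib, Finset.sum_sub_distrib, ← Finset.sum_mul,
    ← Finset.mul_sum, Finset.sum_const, Finset.card_univ, Fintype.card_fin, nsmul_eq_mul]
  field_simp
  ring

/-- Pairwise bounds `c |xᵢ - xⱼ| ≤ sᵢ + sⱼ` control the sum of squared deviations from the mean. -/
theorem sum_sq_sub_mean_le {N : ℕ} (hN : 1 ≤ N) (x s : Fin N → ℝ) {c : ℝ} (hc : 0 ≤ c)
    (h : ∀ i j, c * |x i - x j| ≤ s i + s j) :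
    c ^ 2 * ∑ i, (x i - (1 / (N : ℝ)) * ∑ j, x j) ^ 2 ≤ 2 * ∑ i, s i ^ 2 := by
  have hN' : (0 : ℝ) < N := by positivity
  have hpair : ∑ i, ∑ j, c ^ 2 * (x i - x j) ^ 2 ≤ ∑ i, ∑ j, 2 * (s i ^ 2 + s j ^ 2) := by
    refine Finset.sum_le_sum fun i _ => Finset.sum_le_sum fun j _ => ?_
    have h1 := pow_le_pow_left₀ (by positivity) (h i j) 2
    rw [mul_pow, sq_abs] at h1
    nlinarith [sq_nonneg (s i - s j)]
  have hx : ∑ i, ∑ j, c ^ 2 * (x i - x j) ^ 2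
      = c ^ 2 * (2 * N * ∑ i, x i ^ 2 - 2 * (∑ i, x i) ^ 2) := by
    simp only [sub_sq, ← Finset.mul_sum, Finset.sum_add_distrib, Finset.sum_sub_distrib,
      ← Finset.sum_mul, Finset.sum_const, Finset.card_univ, Fintype.card_fin, nsmul_eq_mul]
    ring
  have hs : ∑ i, ∑ j, 2 * (s i ^ 2 + s j ^ 2) = 4 * N * ∑ i, s i ^ 2 := by
    simp only [← Finset.mul_sum, Finset.sum_add_distrib, Finset.sum_const, Finset.card_univ,
      Fintype.card_fin, nsmul_eq_mul]
    ring
  rw [hx, hs] at hpair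
  rw [sum_sq_sub_mean hN]
  refine le_of_mul_le_mul_left ?_ (mul_pos two_pos hN')
  calc 2 * (N : ℝ) * (c ^ 2 * (∑ i, x i ^ 2 - (∑ i, x i) ^ 2 / N))
      = c ^ 2 * (2 * N * ∑ i, x i ^ 2 - 2 * (∑ i, x i) ^ 2) := by field_simp
    _ ≤ 4 * N * ∑ i, s i ^ 2 := hpair
    _ = 2 * N * (2 * ∑ i, s i ^ 2) := by ring

/-- Perturbation bound for the fixed points of two regularized Bellman operators. -/
theorem norm_fixedPoint_sub_le {S A : Type*} [Fintype S] [Fintype A] [Nonempty A]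
    {γ lam M r p : ℝ} (hγ0 : 0 ≤ γ) (hlam : 1 + lam ≠ 0) (hM : 0 ≤ M) (hr : 0 ≤ r) (hp : 0 ≤ p)
    {Qpi : S × A → ℝ} {P P' : S → A → S → ℝ} {R R' : S → A → ℝ} {Q Q' : S × A → ℝ}
    (hP0 : ∀ s a s', 0 ≤ P' s a s') (hP1 : ∀ s a, ∑ s', P' s a s' = 1)
    (hR : ∀ s a, |R s a - R' s a| ≤ r) (hP : ∀ s a, ∑ s', |P s a s' - P' s a s'| ≤ p)
    (hQ : Bhat P R γ lam Qpi Q = Q) (hQ' : Bhat P' R' γ lam Qpi Q' = Q') (hQM : ‖Q‖ ≤ M) :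
    (|1 + lam| - γ) * ‖Q - Q'‖ ≤ r + γ * p * M := by
  have hm : 0 ≤ ‖Q - Q'‖ := norm_nonneg _
  have key : ‖Q - Q'‖ ≤ (r + γ * p * M + γ * ‖Q - Q'‖) / |1 + lam| := by
    refine (pi_norm_le_iff_of_nonneg (by positivity)).2 fun ⟨s, a⟩ => ?_
    have e1 := congrFun hQ (s, a)
    have e2 := congrFun hQ' (s, a)
    simp only [Bhat] at e1 e2
    have e : (1 + lam) * (Q (s, a) - Q' (s, a)) = (R s a - R' s a)
        + γ * (∑ s', (P s a s' - P' s a s') * maxQ Q s'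
          + ∑ s', P' s a s' * (maxQ Q s' - maxQ Q' s')) := by
      rw [← e1, ← e2]
      simp only [sub_mul, mul_sub, Finset.sum_sub_distrib]
      field_simp
      ring
    have b1 := abs_sum_mul_le (fun s' => P s a s' - P' s a s') (maxQ Q) hM (hP s a)
      fun s' => (abs_maxQ_le Q s').trans hQM
    have b2 := abs_sum_mul_le (P' s a) (fun s' => maxQ Q s' - maxQ Q' s') (c := 1) hm
      (by simp only [abs_of_nonneg (hP0 s a _), hP1, le_refl]) fun s' => abs_maxQ_sub_le Q Q' s'
    rw [Pi.sub_apply, Real.norm_eq_abs, le_div_iff₀ (abs_pos.2 hlam), mul_comm, ← abs_mul, e]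
    calc _ ≤ |R s a - R' s a| + γ * (|∑ s', (P s a s' - P' s a s') * maxQ Q s'|
          + |∑ s', P' s a s' * (maxQ Q s' - maxQ Q' s')|) := by
          refine (abs_add_le _ _).trans ?_
          rw [abs_mul, abs_of_nonneg hγ0]
          gcongr
          exact abs_add_le _ _
      _ ≤ r + γ * (p * M + 1 * ‖Q - Q'‖) := by
          gcongr
          exact hR s a
      _ = _ := by ring
  rw [le_div_iff₀ (abs_pos.2 hlam)] at key
  linarith

/-- Lemma 4 of the paper, pointwise form: with
`g_i = λ(Qπ − Q_i*)` and `ḡ = (1/N)Σ_i g_i`, for every `(s,a)`: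
`(1/N)·Σ_i (g_i(s,a) − ḡ(s,a))² ≤ (8/(λ²−8))·ḡ(s,a)² + 2σ₂²`, where
`σ₂² = (2λ²/(λ²−8))·σ² + (2λ²γ/((λ²−8)(1−γ)))·Rmax` and
`σ² = (1/N)·Σ_i (σ_{1,i} + σ_{2,i}·γ·Rmax/(1−γ))²`. -/
theorem gradient_diversity_bound {S A : Type*} [Fintype S] [Fintype A]
    [Nonempty S] [Nonempty A]
    (N : ℕ) (hN : 1 ≤ N) (γ Rmax lam : ℝ)
    (hγ0 : 0 ≤ γ) (hγ1 : γ < 1) (hRmax : 0 < Rmax) (hlam : 8 < lam^2)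
    (Qpi : S × A → ℝ) (hQpi : ‖Qpi‖ ≤ Rmax / (1 - γ))
    (Rew : Fin N → S → A → ℝ) (P : Fin N → S → A → S → ℝ)
    (hRb : ∀ i s a, |Rew i s a| ≤ Rmax)
    (hP0 : ∀ i s a s', 0 ≤ P i s a s') (hP1 : ∀ i s a, ∑ s', P i s a s' = 1)
    (σ1 σ2 : Fin N → ℝ) (hσ1 : ∀ i, 0 ≤ σ1 i) (hσ2 : ∀ i, 0 ≤ σ2 i)
    (hRdiv : ∀ i s a, |Rew i s a - (1 / (N : ℝ)) * ∑ j, Rew j s a| ≤ σ1 i)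
    (hPdiv : ∀ i s a, ∑ s', |P i s a s' - (1 / (N : ℝ)) * ∑ j, P j s a s'| ≤ σ2 i)
    (Qstar : Fin N → S × A → ℝ)
    (hfix : ∀ i, Bhat (P i) (Rew i) γ lam Qpi (Qstar i) = Qstar i)
    (hQstar : ∀ i, ‖Qstar i‖ ≤ Rmax / (1 - γ))
    (g : Fin N → S × A → ℝ) (hg : ∀ i sa, g i sa = lam * (Qpi sa - Qstar i sa))
    (gbar : S × A → ℝ) (hgbar : ∀ sa, gbar sa = (1 / (N : ℝ)) * ∑ i, g i sa) :
    ∀ sa : S × A,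
      (1 / (N : ℝ)) * ∑ i, (g i sa - gbar sa)^2 ≤
        (8 / (lam^2 - 8)) * (gbar sa)^2 +
        2 * ((2 * lam^2 / (lam^2 - 8)) *
              ((1 / (N : ℝ)) * ∑ i, (σ1 i + σ2 i * γ * Rmax / (1 - γ))^2) +
            (2 * lam^2 * γ / ((lam^2 - 8) * (1 - γ))) * Rmax) := by
  intro sa
  set M := Rmax / (1 - γ) with hMdef
  have hγ : 0 < 1 - γ := by linarith
  have hM : 0 ≤ M := by positivity
  have hL : 2 < |lam| := by
    by_contra! hle
    nlinarith [abs_nonneg lam, sq_abs lam]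
  have h1lam : |lam| - 1 ≤ |1 + lam| := by
    have := abs_sub_abs_le_abs_sub lam (-1)
    rwa [abs_neg, abs_one, sub_neg_eq_add, add_comm lam] at this
  have hne : 1 + lam ≠ 0 := abs_pos.1 (by linarith)
  set s : Fin N → ℝ := fun i => σ1 i + σ2 i * γ * Rmax / (1 - γ) with hs
  have hdiff : ∀ i j, (|lam| - 2) * |Qstar i sa - Qstar j sa| ≤ s i + s j := by
    intro i j
    have hb := norm_fixedPoint_sub_le (r := σ1 i + σ1 j) (p := σ2 i + σ2 j) hγ0 hne hM
      (add_nonneg (hσ1 i) (hσ1 j)) (add_nonneg (hσ2 i) (hσ2 j)) (hP0 j) (hP1 j)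
      (fun t a => (abs_sub_le _ _ _).trans
        (add_le_add (hRdiv i t a) ((abs_sub_comm _ _).trans_le (hRdiv j t a))))
      (fun t a => ?_) (hfix i) (hfix j) (hQstar i)
    · calc (|lam| - 2) * |Qstar i sa - Qstar j sa|
          ≤ (|1 + lam| - γ) * ‖Qstar i - Qstar j‖ := by
            refine mul_le_mul (by linarith) (norm_le_pi_norm (Qstar i - Qstar j) sa)
              (abs_nonneg _) (by linarith)
        _ ≤ _ := hb
        _ = s i + s j := by simp only [hs, hMdef]; ring
    · refine le_trans ?_ (add_le_add (hPdiv i t a) (hPdiv j t a))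
      rw [← Finset.sum_add_distrib]
      refine Finset.sum_le_sum fun t' _ => ?_
      rw [abs_sub_comm (P j t a t')]
      exact abs_sub_le _ _ _
  have hg' : ∀ i j, (|lam| - 2) * |g i sa - g j sa| ≤ |lam| * s i + |lam| * s j := by
    intro i j
    have e : g i sa - g j sa = lam * (Qstar j sa - Qstar i sa) := by rw [hg, hg]; ring
    rw [e, abs_mul, abs_sub_comm]
    nlinarith [mul_le_mul_of_nonneg_left (hdiff i j) (abs_nonneg lam)]
  have hvar := sum_sq_sub_mean_le hN (fun i => g i sa) (fun i => |lam| * s i)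
    (by linarith : 0 ≤ |lam| - 2) hg'
  simp only [mul_pow, sq_abs, ← Finset.mul_sum, ← hgbar] at hvar
  have hlam' : 0 < lam ^ 2 - 8 := by linarith
  have hT : 0 ≤ ∑ i, s i ^ 2 := by positivity
  have hmain : ∑ i, (g i sa - gbar sa) ^ 2 ≤ 4 * lam ^ 2 / (lam ^ 2 - 8) * ∑ i, s i ^ 2 := by
    have hG : 0 ≤ ∑ i, (g i sa - gbar sa) ^ 2 := by positivity
    have hcoef : lam ^ 2 - 8 ≤ 2 * (|lam| - 2) ^ 2 := by
      nlinarith [sq_nonneg (|lam| - 4), sq_abs lam]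
    rw [div_mul_eq_mul_div, le_div_iff₀ hlam']
    nlinarith [mul_le_mul_of_nonneg_left hcoef hG]
  have hfirst : 0 ≤ 8 / (lam ^ 2 - 8) * gbar sa ^ 2 := by positivity
  have hlast : 0 ≤ 2 * lam ^ 2 * γ / ((lam ^ 2 - 8) * (1 - γ)) * Rmax := by positivity
  have hmean := mul_le_mul_of_nonneg_left hmain (by positivity : 0 ≤ 1 / (N : ℝ))
  have hcomm : 1 / (N : ℝ) * (4 * lam ^ 2 / (lam ^ 2 - 8) * ∑ i, s i ^ 2)
      = 2 * (2 * lam ^ 2 / (lam ^ 2 - 8) * (1 / (N : ℝ) * ∑ i, s i ^ 2)) := by ring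
  linarith
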